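/- (Recovery sequence in the rate-independent limit, for absolutely continuous curves.) Let A > 0, let β_n → ∞ and α_n := e^{−β_n A}. Let x ∈ W^{1,1}(0,T) satisfy |∇E(x(t),t)| ≤ A for a.e. t ∈ (0,T). Then there exists a sequence x_n ∈ W^{1,1}(0,T) with x_n(t) → x(t) for every t ∈ [0,T] and ∫₀ᵀ |ẋ_n(t)| dt → ∫₀ᵀ |ẋ(t)| dt, such that limsup_{n→∞} J_{α_n,β_n}(x_n) ≤ A·∫₀ᵀ |ẋ(t)| dt + E(x(T),T) − E(x(0),0) − ∫₀ᵀ ∂_t E(x(t),t) dt. -/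

import Mathlib

open MeasureTheory Real Filter Topology Set

/-- `ψ_{α,β}(v)`, the dissipation potential from Kramers' rates. -/
noncomputable def psi (a b v : ℝ) : ℝ :=
  v / b * Real.log ((v + Real.sqrt (v ^ 2 + 4 * a ^ 2)) / (2 * a))
    - 1 / b * Real.sqrt (v ^ 2 + 4 * a ^ 2) + 2 * a / b

/-- `ψ*_{α,β}(w)`, the dual dissipation potential. -/
noncomputable def psiStar (a b w : ℝ) : ℝ :=
  2 * a / b * (Real.cosh (b * w) - 1)
/-- Slowing time down in proportion to `1 + |y| / M` defines a bijective clock. -/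
lemma exists_slow_clock {y : ℝ → ℝ} (hy : Integrable y) {M : ℝ} (hM : 0 < M) :
    ∃ σ : ℝ ≃o ℝ, ∀ s, σ.symm s = s + M⁻¹ * ∫ r in (0:ℝ)..s, |y r| := by
  have hint : ∀ a b, IntervalIntegrable (fun r => |y r|) volume a b :=
    fun a b => hy.abs.intervalIntegrable
  set τ : ℝ → ℝ := fun s => s + M⁻¹ * ∫ r in (0:ℝ)..s, |y r| with hτ
  have hmono : StrictMono τ := by
    intro a b hab
    have h1 := intervalIntegral.integral_add_adjacent_intervals (hint 0 a) (hint a b)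
    have h2 : 0 ≤ ∫ r in a..b, |y r| :=
      intervalIntegral.integral_nonneg hab.le fun _ _ => abs_nonneg _
    have h3 : M⁻¹ * (∫ r in (0:ℝ)..a, |y r|) ≤ M⁻¹ * ∫ r in (0:ℝ)..b, |y r| := by
      gcongr; linarith
    simp only [hτ]
    linarith
  have hcont : Continuous τ := by
    have := intervalIntegral.continuous_primitive (fun a b => hint a b) 0
    fun_prop
  have htop : Tendsto τ atTop atTop := by
    refine tendsto_atTop_mono' _ ?_ tendsto_id
    filter_upwards [eventually_ge_atTop 0] with s hs
    have h2 : 0 ≤ ∫ r in (0:ℝ)..s, |y r| :=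
      intervalIntegral.integral_nonneg hs fun _ _ => abs_nonneg _
    have := mul_nonneg (inv_nonneg.2 hM.le) h2
    simp only [hτ, id]
    linarith
  have hbot : Tendsto τ atBot atBot := by
    refine tendsto_atBot_mono' _ ?_ tendsto_id
    filter_upwards [eventually_le_atBot 0] with s hs
    have h2 : 0 ≤ ∫ r in s..(0:ℝ), |y r| :=
      intervalIntegral.integral_nonneg hs fun _ _ => abs_nonneg _
    have := mul_nonneg (inv_nonneg.2 hM.le) h2
    simp only [hτ, id]
    rw [intervalIntegral.integral_symm]
    linarith
  refine ⟨(hmono.orderIsoOfSurjective τ (hcont.surjective htop hbot)).symm, fun s => ?_⟩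
  simp [hτ]

/-- The law of Lebesgue measure under a slowed clock. -/
lemma map_slow_clock {y : ℝ → ℝ} (hy : Integrable y) {M : ℝ} (hM : 0 < M)
    (σ : ℝ ≃o ℝ) (hσ : ∀ s, σ.symm s = s + M⁻¹ * ∫ r in (0:ℝ)..s, |y r|) :
    Measure.map σ volume
      = volume.withDensity fun s => ENNReal.ofReal (1 + M⁻¹ * |y s|) := by
  have hint : ∀ a b, IntervalIntegrable (fun r => |y r|) volume a b :=
    fun a b => hy.abs.intervalIntegrable
  have hσm : Measurable σ := σ.continuous.measurable
  have hIoo : ∀ a b : ℝ, a ≤ b → (volume.withDensity fun s => ENNReal.ofReal (1 + M⁻¹ * |y s|))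
      (Ioo a b) = ENNReal.ofReal (σ.symm b - σ.symm a) := by
    intro a b hab
    have hI : IntervalIntegrable (fun s => 1 + M⁻¹ * |y s|) volume a b :=
      intervalIntegrable_const.add ((hint a b).const_mul _)
    rw [withDensity_apply _ measurableSet_Ioo, ← ofReal_integral_eq_lintegral_ofReal]
    · congr 1
      rw [← integral_Ioc_eq_integral_Ioo, ← intervalIntegral.integral_of_le hab,
        intervalIntegral.integral_add intervalIntegrable_const ((hint a b).const_mul _),
        intervalIntegral.integral_const_mul, hσ, hσ,
        ← intervalIntegral.integral_add_adjacent_intervals (hint 0 a) (hint a b)]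
      simp
      ring
    · exact ((intervalIntegrable_iff_integrableOn_Ioc_of_le hab).1 hI).mono_set Ioo_subset_Ioc_self
    · exact ae_of_all _ fun s => by positivity
  have hmap : ∀ a b : ℝ, Measure.map σ volume (Ioo a b)
      = ENNReal.ofReal (σ.symm b - σ.symm a) := by
    intro a b
    rw [Measure.map_apply hσm measurableSet_Ioo, OrderIso.preimage_Ioo, Real.volume_Ioo]
  have : IsLocallyFiniteMeasure (Measure.map σ volume) := by
    refine ⟨fun s => ⟨Ioo (s - 1) (s + 1), Ioo_mem_nhds (by linarith) (by linarith), ?_⟩⟩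
    rw [hmap]
    exact ENNReal.ofReal_lt_top
  refine Real.measure_ext_Ioo_rat fun a b => ?_
  rcases le_total (a : ℝ) b with hab | hab
  · rw [hmap, hIoo _ _ hab]
  · rw [Ioo_eq_empty (not_lt.2 hab), measure_empty, measure_empty]

/-- Change of variables along a slowed clock. -/
lemma integral_comp_slow_clock {y : ℝ → ℝ} (hym : Measurable y) (hy : Integrable y) {M : ℝ}
    (hM : 0 < M) (σ : ℝ ≃o ℝ) (hσ : ∀ s, σ.symm s = s + M⁻¹ * ∫ r in (0:ℝ)..s, |y r|)
    (f : ℝ → ℝ) (a b : ℝ) :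
    ∫ t in a..b, f (σ t) = ∫ s in σ a..σ b, (1 + M⁻¹ * |y s|) * f s := by
  wlog hab : a ≤ b generalizing a b
  · rw [intervalIntegral.integral_symm, this b a (le_of_not_ge hab),
      ← intervalIntegral.integral_symm]
  have he : MeasurableEmbedding σ := σ.toHomeomorph.measurableEmbedding
  have hpre : σ ⁻¹' Ioc (σ a) (σ b) = Ioc a b := by
    rw [OrderIso.preimage_Ioc]; simp
  rw [intervalIntegral.integral_of_le hab, intervalIntegral.integral_of_le (σ.monotone hab),
    ← hpre, ← he.setIntegral_map, map_slow_clock hy hM σ hσ,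
    setIntegral_withDensity_eq_setIntegral_toReal_smul (by fun_prop) (by simp) _ measurableSet_Ioc]
  refine integral_congr_ae (ae_of_all _ fun s => ?_)
  have : 0 ≤ 1 + M⁻¹ * |y s| := by positivity
  simp [ENNReal.toReal_ofReal this]

/-- Chain rule for a `C¹` function along a Lipschitz curve. -/
lemma integral_chain_rule {E DE Et : ℝ → ℝ → ℝ}
    (hDEcont : Continuous fun p : ℝ × ℝ => DE p.1 p.2)
    (hEtcont : Continuous fun p : ℝ × ℝ => Et p.1 p.2)
    (hDE : ∀ y t, HasDerivAt (fun z => E z t) (DE y t) y)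
    (hEt : ∀ y t, HasDerivAt (fun τ => E y τ) (Et y t) t)
    {u v : ℝ → ℝ} {M : ℝ} (hvm : Measurable v) (hv : ∀ t, |v t| ≤ M)
    (hu : ∀ t, u t = u 0 + ∫ s in (0:ℝ)..t, v s) (T : ℝ) :
    ∫ t in (0:ℝ)..T, (v t * DE (u t) t + Et (u t) t) = E (u T) T - E (u 0) 0 := by
  have hM : 0 ≤ M := (abs_nonneg _).trans (hv 0)
  have hloc : LocallyIntegrable v := by
    refine (locallyIntegrable_const M).mono hvm.aestronglyMeasurable (ae_of_all _ fun t => ?_)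
    simpa [abs_of_nonneg hM] using hv t
  have hvi : ∀ a b, IntervalIntegrable v volume a b := fun a b =>
    intervalIntegrable_iff.mpr <|
      (hloc.integrableOn_isCompact isCompact_uIcc).mono_set uIoc_subset_uIcc
  have hulip : LipschitzWith M.toNNReal u := by
    refine LipschitzWith.of_dist_le_mul fun s t => ?_
    have h1 : u s - u t = ∫ r in t..s, v r := by
      rw [hu s, hu t, ← intervalIntegral.integral_add_adjacent_intervals (hvi 0 t) (hvi t s)]
      ring
    rw [Real.dist_eq, h1, Real.coe_toNNReal _ hM, Real.dist_eq]
    exact intervalIntegral.norm_integral_le_of_norm_le_const (f := v) (C := M) fun r _ => hv r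
  let D : ℝ × ℝ → (ℝ × ℝ →L[ℝ] ℝ) := fun p =>
    (ContinuousLinearMap.toSpanSingleton ℝ (DE p.1 p.2)).coprod
      (ContinuousLinearMap.toSpanSingleton ℝ (Et p.1 p.2))
  have hfd : ∀ p, HasFDerivAt (fun p : ℝ × ℝ => E p.1 p.2) (D p) p := by
    intro p
    refine (hasStrictFDerivAt_uncurry_coprod (f := E)
      (f₁ := fun a b => ContinuousLinearMap.toSpanSingleton ℝ (DE a b))
      (f₂ := fun a b => ContinuousLinearMap.toSpanSingleton ℝ (Et a b)) ?_ ?_ ?_ ?_).hasFDerivAt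
    · exact Eventually.of_forall fun q => (hDE q.1 q.2).hasFDerivAt
    · exact Eventually.of_forall fun q => (hEt q.1 q.2).hasFDerivAt
    · exact ((ContinuousLinearMap.toSpanSingletonCLE (𝕜 := ℝ) (E := ℝ)).continuous.comp
        hDEcont).continuousAt
    · exact ((ContinuousLinearMap.toSpanSingletonCLE (𝕜 := ℝ) (E := ℝ)).continuous.comp
        hEtcont).continuousAt
  have hDcont : Continuous D := by
    have h1 : Continuous fun p : ℝ × ℝ => ContinuousLinearMap.toSpanSingleton ℝ (DE p.1 p.2) :=
      (ContinuousLinearMap.toSpanSingletonCLE (𝕜 := ℝ) (E := ℝ)).continuous.comp hDEcont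
    have h2 : Continuous fun p : ℝ × ℝ => ContinuousLinearMap.toSpanSingleton ℝ (Et p.1 p.2) :=
      (ContinuousLinearMap.toSpanSingletonCLE (𝕜 := ℝ) (E := ℝ)).continuous.comp hEtcont
    fun_prop
  have hC1 : ContDiff ℝ 1 (fun p : ℝ × ℝ => E p.1 p.2) :=
    contDiff_one_iff_hasFDerivAt.2 ⟨D, hDcont, hfd⟩
  have hgl : LipschitzWith (max M.toNNReal 1) (fun t => (u t, t)) :=
    hulip.prodMk LipschitzWith.id
  obtain ⟨r, hr⟩ := (isCompact_uIcc.image hgl.continuous :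
    IsCompact ((fun t => (u t, t)) '' uIcc 0 T)).isBounded.subset_closedBall 0
  obtain ⟨K, hK⟩ := hC1.contDiffOn.exists_lipschitzOnWith (by decide)
    (convex_closedBall (0 : ℝ × ℝ) r) (isCompact_closedBall 0 r)
  have hac : AbsolutelyContinuousOnInterval (fun t => E (u t) t) 0 T :=
    (hK.comp hgl.lipschitzOnWith fun t ht =>
      hr (mem_image_of_mem _ ht)).absolutelyContinuousOnInterval
  rw [← hac.integral_deriv_eq_sub]
  refine intervalIntegral.integral_congr_ae ?_
  filter_upwards [_root_.LocallyIntegrable.ae_hasDerivAt_integral hloc] with t ht _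
  have h1 : HasDerivAt u (v t) t := by
    rw [funext hu]
    exact (ht 0).const_add _
  have h2 := (hfd (u t, t)).comp_hasDerivAt (f := fun s => (u s, s)) t (h1.prodMk (hasDerivAt_id t))
  refine Eq.symm (h2.deriv.trans ?_)
  simp [D]

/-- At most logarithmic excess of `ψ` over the rate-independent dissipation for bounded rates. -/
lemma psi_le {a b v M : ℝ} (ha : 0 < a) (ha1 : a ≤ 1) (hb : 0 < b) (hv : |v| ≤ M) :
    psi a b v ≤ |v| / b * (Real.log (M + 1) - Real.log a) + 2 / b := by
  have hs : 0 < v ^ 2 + 4 * a ^ 2 := by positivity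
  set S := Real.sqrt (v ^ 2 + 4 * a ^ 2) with hS
  have hSq : S ^ 2 = v ^ 2 + 4 * a ^ 2 := Real.sq_sqrt hs.le
  have hS0 : 0 < S := Real.sqrt_pos.2 hs
  have hvS : |v| < S := by
    rw [← sq_abs v] at hSq
    nlinarith [abs_nonneg v, pow_pos ha 2]
  have hSle : S ≤ |v| + 2 * a := by
    rw [hS]
    refine Real.sqrt_le_iff.2 ⟨by positivity, ?_⟩
    nlinarith [abs_nonneg v, sq_abs v]
  have hpos1 : 0 < v + S := by linarith [neg_abs_le v]
  have heven : v * Real.log ((v + S) / (2 * a)) = |v| * Real.log ((|v| + S) / (2 * a)) := by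
    rcases abs_cases v with ⟨h, _⟩ | ⟨h, h0⟩
    · rw [h]
    · have : (v + S) / (2 * a) = ((-v + S) / (2 * a))⁻¹ := by
        have : -v + S ≠ 0 := by linarith
        field_simp
        nlinarith
      rw [h, this, Real.log_inv]
      ring
  have hlog : Real.log ((|v| + S) / (2 * a)) ≤ Real.log (M + 1) - Real.log a := by
    rw [← Real.log_div (by linarith [abs_nonneg v]) ha.ne']
    refine Real.log_le_log (by positivity) ?_
    rw [div_le_div_iff₀ (by positivity) ha]
    nlinarith
  have h1 : psi a b v = |v| / b * Real.log ((|v| + S) / (2 * a)) - 1 / b * S + 2 * a / b := by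
    unfold psi
    rw [← hS, div_mul_eq_mul_div, heven, ← div_mul_eq_mul_div]
  have h2 : |v| / b * Real.log ((|v| + S) / (2 * a))
      ≤ |v| / b * (Real.log (M + 1) - Real.log a) := by gcongr
  have h3 : 0 ≤ 1 / b * S := by positivity
  have h4 : 2 * a / b ≤ 2 / b := by gcongr; linarith
  linarith

/-- Exponential upper bound for `ψ*`. -/
lemma psiStar_le {a b w : ℝ} (ha : 0 < a) (hb : 0 < b) :
    psiStar a b w ≤ 2 * a / b * Real.exp (b * |w|) := by
  unfold psiStar
  gcongr
  have h1 : Real.cosh (b * w) ≤ Real.exp (b * |w|) := by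
    rw [← Real.cosh_abs, abs_mul, abs_of_pos hb, Real.cosh_eq]
    have : Real.exp (-(b * |w|)) ≤ Real.exp (b * |w|) :=
      Real.exp_le_exp.2 (by nlinarith [abs_nonneg w])
    linarith
  linarith


/-- recovery sequence in the rate-independent limit, for absolutely
continuous curves: let `A > 0`, `β_n → ∞`, `α_n = e^{−β_n A}`, and let
`x ∈ W^{1,1}(0,T)` with `|∇E(x(t),t)| ≤ A` for a.e. `t ∈ (0,T)`.  Then there is a
sequence `x_n ∈ W^{1,1}(0,T)` converging to `x` pointwise on `[0,T]` with
`∫₀ᵀ |ẋ_n| → ∫₀ᵀ |ẋ|`, such that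
`limsup_n J_{α_n,β_n}(x_n) ≤ A ∫₀ᵀ |ẋ| + E(x(T),T) − E(x(0),0) − ∫₀ᵀ ∂_t E(x(t),t) dt`. -/
theorem rate_independent_recovery
    (T : ℝ) (hT : 0 < T)
    -- the energy `E`, spatial derivative `∇E = DE`, time derivative `∂_t E = Et`
    (E DE Et : ℝ → ℝ → ℝ) (R L : ℝ)
    (hEcont : Continuous fun p : ℝ × ℝ => E p.1 p.2)
    (hDEcont : Continuous fun p : ℝ × ℝ => DE p.1 p.2)
    (hEtcont : Continuous fun p : ℝ × ℝ => Et p.1 p.2)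
    (hDE : ∀ y t, HasDerivAt (fun z => E z t) (DE y t) y)
    (hEt : ∀ y t, HasDerivAt (fun τ => E y τ) (Et y t) t)
    (hEnonneg : ∀ y t, 0 ≤ E y t)
    (hDEbound : ∀ y t, |DE y t| ≤ R)
    (hDELip : ∀ y s t, |DE y t - DE y s| ≤ L * |t - s|)
    -- the scaling regime
    (A : ℝ) (hA : 0 < A)
    (β : ℕ → ℝ) (hβpos : ∀ n, 0 < β n) (hβ : Tendsto β atTop atTop)
    -- the limiting curve `x` in `W^{1,1}(0,T)`
    (x x' : ℝ → ℝ)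
    (hx'int : IntegrableOn x' (Set.Ioo 0 T))
    (hxac : ∀ t ∈ Set.Icc 0 T, x t = x 0 + ∫ s in (0:ℝ)..t, x' s)
    (hEtint : IntegrableOn (fun s => Et (x s) s) (Set.Ioo 0 T))
    (hstable : ∀ᵐ t ∂(volume.restrict (Set.Ioo 0 T)), |DE (x t) t| ≤ A) :
    ∃ xn xn' : ℕ → ℝ → ℝ,
      (∀ n, IntegrableOn (xn' n) (Set.Ioo 0 T)) ∧
      (∀ n, ∀ t ∈ Set.Icc 0 T, xn n t = xn n 0 + ∫ s in (0:ℝ)..t, xn' n s) ∧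
      (∀ t ∈ Set.Icc 0 T, Tendsto (fun n => xn n t) atTop (𝓝 (x t))) ∧
      Tendsto (fun n => ∫ t in Set.Ioo 0 T, |xn' n t|) atTop
        (𝓝 (∫ t in Set.Ioo 0 T, |x' t|)) ∧
      Filter.limsup
          (fun n => ∫⁻ t in Set.Ioo 0 T, ENNReal.ofReal
            (psi (Real.exp (-β n * A)) (β n) (xn' n t)
              + psiStar (Real.exp (-β n * A)) (β n) (DE (xn n t) t)
              + xn' n t * DE (xn n t) t))
          Filter.atTop ≤
        ENNReal.ofReal
          (A * (∫ t in Set.Ioo 0 T, |x' t|) + E (x T) T - E (x 0) 0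
            - ∫ t in Set.Ioo 0 T, Et (x t) t) := by
  set y : ℝ → ℝ := (Ioo 0 T).indicator (hx'int.1.mk x') with hy_def
  have hym : Measurable y :=
    hx'int.1.stronglyMeasurable_mk.measurable.indicator measurableSet_Ioo
  have hyi : Integrable y :=
    (integrable_indicator_iff measurableSet_Ioo).2 (hx'int.congr hx'int.1.ae_eq_mk)
  have hae : ∀ᵐ t ∂(volume.restrict (Ioo 0 T)), x' t = y t := by
    filter_upwards [hx'int.1.ae_eq_mk, ae_restrict_mem measurableSet_Ioo] with t h1 h2
    rw [hy_def, indicator_of_mem h2, h1]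
  have hyI : ∀ a b, IntervalIntegrable y volume a b := fun a b => hyi.intervalIntegrable
  have hyA : ∀ a b, IntervalIntegrable (fun s => |y s|) volume a b :=
    fun a b => hyi.abs.intervalIntegrable
  set V : ℝ → ℝ := fun s => ∫ r in (0:ℝ)..s, |y r| with hV
  set W : ℝ := ∫ r, |y r| with hW
  have hVcont : Continuous V := intervalIntegral.continuous_primitive hyA 0
  have hW0 : 0 ≤ W := integral_nonneg fun _ => abs_nonneg _
  have hV0 : ∀ s, 0 ≤ s → 0 ≤ V s := fun s hs =>
    intervalIntegral.integral_nonneg hs fun _ _ => abs_nonneg _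
  have hVW : ∀ s, 0 ≤ s → V s ≤ W := by
    intro s hs
    simp only [hV, hW]
    rw [intervalIntegral.integral_of_le hs]
    exact setIntegral_le_integral hyi.abs (ae_of_all _ fun _ => abs_nonneg _)
  have hVT : V T = ∫ t in Ioo 0 T, |x' t| := by
    simp only [hV]
    rw [intervalIntegral.integral_of_le hT.le, integral_Ioc_eq_integral_Ioo]
    refine integral_congr_ae ?_
    filter_upwards [hae] with t ht
    rw [ht]
  set X : ℝ → ℝ := fun s => x 0 + ∫ r in (0:ℝ)..s, y r with hX
  have hXcont : Continuous X :=
    continuous_const.add (intervalIntegral.continuous_primitive hyI 0)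
  have hXx : ∀ t ∈ Icc 0 T, X t = x t := by
    intro t ht
    rw [hxac t ht]
    simp only [hX]
    congr 1
    rw [intervalIntegral.integral_of_le ht.1, intervalIntegral.integral_of_le ht.1,
      integral_Ioc_eq_integral_Ioo, integral_Ioc_eq_integral_Ioo]
    refine integral_congr_ae ?_
    filter_upwards [ae_restrict_of_ae_restrict_of_subset (Ioo_subset_Ioo_right ht.2) hae] with s hs
    exact hs.symm
  have hX0 : X 0 = x 0 := hXx 0 ⟨le_rfl, hT.le⟩
  have hstab : ∀ s ∈ Icc 0 T, |DE (X s) s| ≤ A := by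
    have hcl : IsClosed {s | |DE (X s) s| ≤ A} :=
      isClosed_le (hDEcont.comp (hXcont.prodMk continuous_id)).abs continuous_const
    have hsub : Ioo 0 T ⊆ {s | |DE (X s) s| ≤ A} := by
      have hopen : IsOpen (Ioo 0 T ∩ {s | |DE (X s) s| ≤ A}ᶜ) := isOpen_Ioo.inter hcl.isOpen_compl
      have hnull : volume (Ioo 0 T ∩ {s | |DE (X s) s| ≤ A}ᶜ) = 0 := by
        have h := (ae_restrict_iff' measurableSet_Ioo).1 hstable
        refine measure_mono_null ?_ h
        rintro s ⟨hs, hs'⟩ hcon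
        refine hs' ?_
        have := hcon hs
        rwa [← hXx s (Ioo_subset_Icc_self hs)] at this
      have hempty := hopen.eq_empty_of_measure_zero hnull
      intro s hs
      by_contra hcon
      exact (hempty ▸ (⟨hs, hcon⟩ : s ∈ Ioo 0 T ∩ {s | |DE (X s) s| ≤ A}ᶜ) : s ∈ (∅ : Set ℝ))
    intro s hs
    have := hcl.closure_subset_iff.2 hsub
    rw [closure_Ioo hT.ne] at this
    exact this hs
  have hL : 0 ≤ L := by
    have := (abs_nonneg _).trans (hDELip 0 0 1)
    simpa using this
  choose σ hσ using fun n => exists_slow_clock hyi (hβpos n)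
  have hσcont : ∀ n, Continuous (σ n) := fun n => (σ n).continuous
  have hσeq : ∀ n t, t = σ n t + (β n)⁻¹ * V (σ n t) := by
    intro n t
    have := hσ n (σ n t)
    rwa [OrderIso.symm_apply_apply] at this
  have hσ0 : ∀ n, σ n 0 = 0 := by
    intro n
    have := hσ n 0
    rw [intervalIntegral.integral_same, mul_zero, add_zero] at this
    rw [← this, OrderIso.apply_symm_apply, this]
  have hσnonneg : ∀ n t, 0 ≤ t → 0 ≤ σ n t := fun n t ht => hσ0 n ▸ (σ n).monotone ht
  have hσle : ∀ n t, 0 ≤ t → σ n t ≤ t := by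
    intro n t ht
    have h1 := hσeq n t
    have h2 := mul_nonneg (inv_nonneg.2 (hβpos n).le) (hV0 _ (hσnonneg n t ht))
    linarith
  have hσge : ∀ n t, 0 ≤ t → t - σ n t ≤ W / β n := by
    intro n t ht
    have h1 := hσeq n t
    have h2 := mul_le_mul_of_nonneg_left (hVW _ (hσnonneg n t ht)) (inv_nonneg.2 (hβpos n).le)
    rw [div_eq_inv_mul]
    linarith
  have hσtend : ∀ t, 0 ≤ t → Tendsto (fun n => σ n t) atTop (𝓝 t) := by
    intro t ht
    have h1 : Tendsto (fun n => t - W / β n) atTop (𝓝 (t - 0)) :=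
      tendsto_const_nhds.sub (hβ.const_div_atTop W)
    rw [sub_zero] at h1
    exact tendsto_of_tendsto_of_tendsto_of_le_of_le h1 tendsto_const_nhds
      (fun n => by have := hσge n t ht; simp only; linarith) fun n => hσle n t ht
  have hden : ∀ n s, 0 < 1 + (β n)⁻¹ * |y s| := fun n s => by
    have := hβpos n
    positivity
  set g : ℕ → ℝ → ℝ := fun n s => y s / (1 + (β n)⁻¹ * |y s|) with hg
  have hgm : ∀ n, Measurable (g n) := fun n => by simp only [hg]; fun_prop
  have hgabs : ∀ n s, |g n s| = |y s| / (1 + (β n)⁻¹ * |y s|) := fun n s => by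
    simp only [hg]
    rw [abs_div, abs_of_pos (hden n s)]
  have hgbd : ∀ n s, |g n s| ≤ β n := by
    intro n s
    rw [hgabs, div_le_iff₀ (hden n s), mul_add, mul_inv_cancel_left₀ (hβpos n).ne']
    linarith [hβpos n]
  have hvm : ∀ n, Measurable fun t => g n (σ n t) := fun n =>
    (hgm n).comp (hσcont n).measurable
  have hvi : ∀ n a b, IntervalIntegrable (fun t => g n (σ n t)) volume a b := fun n a b =>
    (intervalIntegrable_const (c := β n)).mono_fun (hvm n).aestronglyMeasurable
      (ae_of_all _ fun t => by simpa [abs_of_pos (hβpos n)] using hgbd n (σ n t))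
  have hprim : ∀ n t, X (σ n t) = X (σ n 0) + ∫ s in (0:ℝ)..t, g n (σ n s) := by
    intro n t
    rw [integral_comp_slow_clock hym hyi (hβpos n) (σ n) (hσ n) (g n), hσ0, hX0]
    simp only [hX, hg]
    congr 1
    refine intervalIntegral.integral_congr fun s _ => ?_
    exact (mul_div_cancel₀ _ (hden n s).ne').symm
  have habs : ∀ n, ∫ t in (0:ℝ)..T, |g n (σ n t)| = V (σ n T) := by
    intro n
    rw [integral_comp_slow_clock hym hyi (hβpos n) (σ n) (hσ n) (fun s => |g n s|), hσ0]
    refine intervalIntegral.integral_congr fun s _ => ?_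
    simp only [hgabs]
    exact mul_div_cancel₀ _ (hden n s).ne'
  have hxntend : ∀ t, 0 ≤ t → Tendsto (fun n => X (σ n t)) atTop (𝓝 (X t)) := fun t ht =>
    (hXcont.tendsto t).comp (hσtend t ht)
  have hVtend : Tendsto (fun n => V (σ n T)) atTop (𝓝 (V T)) :=
    (hVcont.tendsto T).comp (hσtend T hT.le)
  refine ⟨fun n t => X (σ n t), fun n t => g n (σ n t), fun n => ?_, fun n t _ => hprim n t,
    fun t ht => hXx t ht ▸ hxntend t ht.1, ?_, ?_⟩
  · exact ((intervalIntegrable_iff_integrableOn_Ioc_of_le hT.le).1 (hvi n 0 T)).mono_set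
      Ioo_subset_Ioc_self
  · rw [← hVT]
    refine hVtend.congr fun n => ?_
    rw [← habs, intervalIntegral.integral_of_le hT.le, integral_Ioc_eq_integral_Ioo]
  set c : ℕ → ℝ := fun n =>
    (Real.log (β n + 1) + 2 + 2 * Real.exp (L * W) + L * W) / β n with hc
  have hctend : Tendsto c atTop (𝓝 0) := by
    have h1 : Tendsto (fun b : ℝ => Real.log (b + 1) / b) atTop (𝓝 0) := by
      have h2 : Tendsto (fun b : ℝ => Real.log b / b) atTop (𝓝 0) := by
        simpa using Real.isLittleO_log_id_atTop.tendsto_div_nhds_zero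
      have h3 : Tendsto (fun b : ℝ => (Real.log 2 + Real.log b) / b) atTop (𝓝 0) := by
        simpa [add_div] using
          (tendsto_id.const_div_atTop (Real.log 2) (l := (atTop : Filter ℝ))).add h2
      refine squeeze_zero' ?_ ?_ h3
      · filter_upwards [eventually_ge_atTop 1] with b hb
        exact div_nonneg (Real.log_nonneg (by linarith)) (by linarith)
      · filter_upwards [eventually_ge_atTop 1] with b hb
        rw [← Real.log_mul (by norm_num) (by linarith)]
        exact div_le_div_of_nonneg_right (Real.log_le_log (by linarith) (by linarith))
          (by linarith)
    have h4 := (h1.comp hβ).add (hβ.const_div_atTop (2 + 2 * Real.exp (L * W) + L * W))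
    rw [add_zero] at h4
    refine h4.congr fun n => ?_
    simp only [hc, Function.comp]
    ring
  have hDEn : ∀ n, ∀ t ∈ Icc 0 T, |DE (X (σ n t)) t| ≤ A + L * W / β n := by
    intro n t ht
    have h1 := hstab (σ n t) ⟨hσnonneg n t ht.1, (hσle n t ht.1).trans ht.2⟩
    have h2 := hDELip (X (σ n t)) (σ n t) t
    rw [abs_of_nonneg (sub_nonneg.2 (hσle n t ht.1))] at h2
    have h3 := mul_le_mul_of_nonneg_left (hσge n t ht.1) hL
    have h4 := abs_sub_abs_le_abs_sub (DE (X (σ n t)) t) (DE (X (σ n t)) (σ n t))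
    rw [mul_div_assoc]
    linarith
  have hparts : ∀ n, 0 ≤ Real.log (β n + 1) / β n ∧ 0 ≤ 2 * Real.exp (L * W) / β n
      ∧ 0 ≤ L * W / β n ∧ 0 ≤ 2 / β n ∧ c n = Real.log (β n + 1) / β n + 2 / β n
        + 2 * Real.exp (L * W) / β n + L * W / β n := by
    intro n
    have hb := hβpos n
    refine ⟨div_nonneg (Real.log_nonneg (by linarith)) hb.le, by positivity, by positivity,
      by positivity, ?_⟩
    simp only [hc]
    ring
  have hptwise : ∀ n, ∀ t ∈ Icc 0 T,
      psi (Real.exp (-β n * A)) (β n) (g n (σ n t))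
        + psiStar (Real.exp (-β n * A)) (β n) (DE (X (σ n t)) t)
        + g n (σ n t) * DE (X (σ n t)) t
      ≤ (A + c n) * |g n (σ n t)| + c n + g n (σ n t) * DE (X (σ n t)) t := by
    intro n t ht
    have hb := hβpos n
    obtain ⟨p1, p2, p3, p4, p5⟩ := hparts n
    have h1 := psi_le (Real.exp_pos (-β n * A)) (Real.exp_le_one_iff.2 (by nlinarith)) hb
      (hgbd n (σ n t))
    rw [Real.log_exp] at h1
    have h2 := psiStar_le (w := DE (X (σ n t)) t) (Real.exp_pos (-β n * A)) hb
    have h3 : 2 * Real.exp (-β n * A) / β n * Real.exp (β n * |DE (X (σ n t)) t|)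
        ≤ 2 * Real.exp (L * W) / β n := by
      rw [div_mul_eq_mul_div, mul_assoc, ← Real.exp_add]
      gcongr
      have h4 := mul_le_mul_of_nonneg_left (hDEn n t ht) hb.le
      rw [mul_add, mul_div_cancel₀ _ hb.ne'] at h4
      linarith
    have h5 : |g n (σ n t)| / β n * (Real.log (β n + 1) - -β n * A)
        = (A + Real.log (β n + 1) / β n) * |g n (σ n t)| := by
      field_simp
      ring
    have h6 : (A + Real.log (β n + 1) / β n) * |g n (σ n t)| ≤ (A + c n) * |g n (σ n t)| := by
      gcongr
      linarith
    linarith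
  have hnonneg : ∀ n, ∀ t ∈ Icc 0 T,
      0 ≤ (A + c n) * |g n (σ n t)| + c n + g n (σ n t) * DE (X (σ n t)) t := by
    intro n t ht
    obtain ⟨p1, p2, p3, p4, p5⟩ := hparts n
    have h1 : |DE (X (σ n t)) t| ≤ A + c n := (hDEn n t ht).trans (by linarith)
    have h2 := neg_abs_le (g n (σ n t) * DE (X (σ n t)) t)
    rw [abs_mul] at h2
    have h3 := mul_le_mul_of_nonneg_left h1 (abs_nonneg (g n (σ n t)))
    linarith
  have hcurve : ∀ n, Continuous fun t => (X (σ n t), t) := fun n =>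
    (hXcont.comp (hσcont n)).prodMk continuous_id
  have hEtI : ∀ n, IntervalIntegrable (fun t => Et (X (σ n t)) t) volume 0 T := fun n =>
    (hEtcont.comp (hcurve n)).intervalIntegrable _ _
  have hprodI : ∀ n, IntervalIntegrable (fun t => g n (σ n t) * DE (X (σ n t)) t) volume 0 T :=
    fun n => (hvi n 0 T).mul_continuousOn (hDEcont.comp (hcurve n)).continuousOn
  have habsI : ∀ n, IntervalIntegrable (fun t => (A + c n) * |g n (σ n t)| + c n) volume 0 T :=
    fun n => ((hvi n 0 T).abs.const_mul _).add intervalIntegrable_const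
  have hvalue : ∀ n, ∫ t in (0:ℝ)..T,
      ((A + c n) * |g n (σ n t)| + c n + g n (σ n t) * DE (X (σ n t)) t)
      = (A + c n) * V (σ n T) + T * c n
        + (E (X (σ n T)) T - E (X 0) 0 - ∫ t in (0:ℝ)..T, Et (X (σ n t)) t) := by
    intro n
    have h1 := integral_chain_rule hDEcont hEtcont hDE hEt (hvm n) (fun t => hgbd n (σ n t))
      (hprim n) T
    rw [intervalIntegral.integral_add (hprodI n) (hEtI n), hσ0] at h1
    rw [intervalIntegral.integral_add (habsI n) (hprodI n),
      intervalIntegral.integral_add ((hvi n 0 T).abs.const_mul _) intervalIntegrable_const,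
      intervalIntegral.integral_const_mul, habs, intervalIntegral.integral_const, ← h1]
    simp
  have hEttend : Tendsto (fun n => ∫ t in (0:ℝ)..T, Et (X (σ n t)) t) atTop
      (𝓝 (∫ t in (0:ℝ)..T, Et (X t) t)) := by
    have hcompact : IsCompact ((X '' Icc 0 T) ×ˢ Icc 0 T) :=
      (isCompact_Icc.image hXcont).prod isCompact_Icc
    obtain ⟨C, hC⟩ := hcompact.exists_bound_of_continuousOn hEtcont.continuousOn
    refine intervalIntegral.tendsto_integral_filter_of_dominated_convergence (fun _ => C) ?_ ?_
      intervalIntegrable_const ?_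
    · exact Eventually.of_forall fun n => (hEtcont.comp (hcurve n)).aestronglyMeasurable
    · refine Eventually.of_forall fun n => ae_of_all _ fun t ht => ?_
      rw [uIoc_of_le hT.le] at ht
      exact hC (X (σ n t), t) ⟨mem_image_of_mem _
        ⟨hσnonneg n t ht.1.le, (hσle n t ht.1.le).trans ht.2⟩, ht.1.le, ht.2⟩
    · refine ae_of_all _ fun t ht => ?_
      rw [uIoc_of_le hT.le] at ht
      exact (hEtcont.tendsto (X t, t)).comp ((hxntend t ht.1.le).prodMk_nhds tendsto_const_nhds)
  have hEtX : ∫ t in (0:ℝ)..T, Et (X t) t = ∫ t in Ioo 0 T, Et (x t) t := by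
    rw [intervalIntegral.integral_of_le hT.le, integral_Ioc_eq_integral_Ioo]
    refine setIntegral_congr_fun measurableSet_Ioo fun t ht => ?_
    simp only [hXx t (Ioo_subset_Icc_self ht)]
  have hlim : Tendsto (fun n => ENNReal.ofReal ((A + c n) * V (σ n T) + T * c n
      + (E (X (σ n T)) T - E (X 0) 0 - ∫ t in (0:ℝ)..T, Et (X (σ n t)) t))) atTop
      (𝓝 (ENNReal.ofReal (A * (∫ t in Ioo 0 T, |x' t|) + E (x T) T - E (x 0) 0
            - ∫ t in Ioo 0 T, Et (x t) t))) := by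
    refine ENNReal.tendsto_ofReal ?_
    have hE : Tendsto (fun n => E (X (σ n T)) T) atTop (𝓝 (E (X T) T)) :=
      (hEcont.tendsto (X T, T)).comp ((hxntend T hT.le).prodMk_nhds tendsto_const_nhds)
    have h := (((hctend.const_add A).mul hVtend).add (hctend.const_mul T)).add
      ((hE.sub_const (E (X 0) 0)).sub hEttend)
    rw [hEtX, hX0, hXx T ⟨hT.le, le_rfl⟩, hVT] at h
    rw [hX0]
    convert h using 2
    ring
  rw [← hlim.limsup_eq]
  refine limsup_le_limsup (Eventually.of_forall fun n => ?_)
  simp only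
  rw [← hvalue, intervalIntegral.integral_of_le hT.le, integral_Ioc_eq_integral_Ioo,
    ofReal_integral_eq_lintegral_ofReal]
  · refine setLIntegral_mono_ae' measurableSet_Ioo (ae_of_all _ fun t ht => ?_)
    exact ENNReal.ofReal_le_ofReal (hptwise n t (Ioo_subset_Icc_self ht))
  · exact ((intervalIntegrable_iff_integrableOn_Ioc_of_le hT.le).1
      ((habsI n).add (hprodI n))).mono_set Ioo_subset_Ioc_self
  · exact (ae_restrict_iff' measurableSet_Ioo).2
      (ae_of_all _ fun t ht => hnonneg n t (Ioo_subset_Icc_self ht))
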